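/- Let A be a finite dimensional algebra over a field k and M an A-module whose underlying k-vector space has dimension at most ℵ_t for a finite ordinal t. Then M has pure projective dimension at most t + 1; in particular, if M is countably generated (t = 0), M has pure projective dimension at most 1. -/

import Mathlib

open Function DirectSum
open scoped DirectSum

universe u v

/-- A module is pure projective if it is a direct summand of a direct sum of finitely
presented modules. -/
def IsPureProjective (A : Type u) [Ring A] (P : Type v) [AddCommGroup P] [Module A P] :
    Prop :=
  ∃ (κ : Type v) (F : κ → ModuleCat.{v} A),
    (∀ i, Module.FinitePresentation A (F i)) ∧
    ∃ (s : P →ₗ[A] (⨁ i, (F i : Type v))) (r : (⨁ i, (F i : Type v)) →ₗ[A] P),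
      r ∘ₗ s = LinearMap.id

/-- A surjection is a pure epimorphism if every map from a finitely presented module to
its target lifts; a pure exact sequence is one whose epimorphism is pure. -/
def IsPureEpi (A : Type u) [Ring A] {B C : Type v} [AddCommGroup B] [Module A B]
    [AddCommGroup C] [Module A C] (p : B →ₗ[A] C) : Prop :=
  Function.Surjective p ∧
  ∀ (F : ModuleCat.{v} A), Module.FinitePresentation A F →
    ∀ g : (F : Type v) →ₗ[A] C, ∃ h : (F : Type v) →ₗ[A] B, p ∘ₗ h = g

/-- `PureProjDimLE A n M` : `M` has pure projective dimension at most `n`, defined via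
pure resolutions: dimension `≤ 0` means pure projective, and dimension `≤ n+1` means `M`
is the target of a pure epimorphism from a pure projective module whose kernel has pure
projective dimension `≤ n`. -/
def PureProjDimLE (A : Type u) [Ring A] :
    ℕ → ∀ (M : Type v) [AddCommGroup M] [Module A M], Prop
  | 0, M, _, _ => IsPureProjective A M
  | n + 1, M, _, _ =>
    ∃ (P K : ModuleCat.{v} A) (p : (P : Type v) →ₗ[A] M) (j : (K : Type v) →ₗ[A] P),
      IsPureProjective A (P : Type v) ∧ IsPureEpi A p ∧ Function.Injective j ∧
      LinearMap.range j = LinearMap.ker p ∧ PureProjDimLE A n (K : Type v)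

open Classical in
theorem pp_retract {A : Type u} [Ring A] {P Q : Type u} [AddCommGroup P] [Module A P]
    [AddCommGroup Q] [Module A Q] (h : IsPureProjective A P) (s : Q →ₗ[A] P) (r : P →ₗ[A] Q)
    (hrs : ∀ x, r (s x) = x) : IsPureProjective A Q := by
  obtain ⟨κ, F, hF, s', r', h'⟩ := h
  refine ⟨κ, F, hF, s' ∘ₗ s, r ∘ₗ r', ?_⟩
  ext x
  have := LinearMap.congr_fun h' (s x)
  simp at this
  simp [this, hrs]

theorem pe_equiv {A : Type u} [Ring A] {B C D : Type u} [AddCommGroup B] [Module A B]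
    [AddCommGroup C] [Module A C] [AddCommGroup D] [Module A D] {p : B →ₗ[A] C}
    (h : IsPureEpi A p) {q : C →ₗ[A] D} (h' : IsPureEpi A q) : IsPureEpi A (q ∘ₗ p) := by
  refine ⟨h'.1.comp h.1, fun F hF g => ?_⟩
  obtain ⟨a, ha⟩ := h'.2 F hF g
  obtain ⟨b, hb⟩ := h.2 F hF a
  exact ⟨b, by rw [LinearMap.comp_assoc, hb, ha]⟩

theorem pe_of_lift {A : Type u} [Ring A] {B C : Type u} [AddCommGroup B] [Module A B]
    [AddCommGroup C] [Module A C] (p : B →ₗ[A] C)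
    (h : ∀ (F : ModuleCat.{u} A), Module.FinitePresentation A F →
      ∀ g : (F : Type u) →ₗ[A] C, ∃ h : (F : Type u) →ₗ[A] B, ∀ x, p (h x) = g x) :
    IsPureEpi A p := by
  refine ⟨fun c => ?_, fun F hF g => ?_⟩
  · obtain ⟨f, hf⟩ := h (ModuleCat.of A A) (inferInstanceAs (Module.FinitePresentation A A))
      (LinearMap.toSpanSingleton A C c)
    exact ⟨f (1 : A), by rw [hf]; simp [LinearMap.toSpanSingleton]⟩
  · obtain ⟨f, hf⟩ := h F hF g
    exact ⟨f, LinearMap.ext hf⟩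

theorem pe_of_equiv {A : Type u} [Ring A] {B C : Type u} [AddCommGroup B] [Module A B]
    [AddCommGroup C] [Module A C] (e : B ≃ₗ[A] C) : IsPureEpi A (e : B →ₗ[A] C) :=
  pe_of_lift _ fun _ _ g => ⟨e.symm.toLinearMap ∘ₗ g, fun x => by simp⟩

theorem ppd_equiv {A : Type u} [Ring A] {n : ℕ} {B C : Type u} [AddCommGroup B] [Module A B]
    [AddCommGroup C] [Module A C] (e : B ≃ₗ[A] C) (h : PureProjDimLE A n B) :
    PureProjDimLE A n C := by
  cases n with
  | zero =>
    unfold PureProjDimLE at h ⊢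
    exact pp_retract h e.symm.toLinearMap e.toLinearMap (by simp)
  | succ n =>
    unfold PureProjDimLE at h ⊢
    obtain ⟨P, K, p, j, h1, h2, h3, h4, h5⟩ := h
    refine ⟨P, K, e.toLinearMap ∘ₗ p, j, h1, pe_equiv h2 (pe_of_equiv e), h3, ?_, h5⟩
    rw [h4]; ext x; simp

theorem ppd_succ_iff {A : Type u} [Ring A] {n : ℕ} {M : Type u} [AddCommGroup M] [Module A M] :
    PureProjDimLE A (n + 1) M ↔ ∃ (P : ModuleCat.{u} A) (p : (P : Type u) →ₗ[A] M),
      IsPureProjective A P ∧ IsPureEpi A p ∧ PureProjDimLE A n (LinearMap.ker p) := by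
  constructor
  · intro h
    unfold PureProjDimLE at h
    obtain ⟨P, K, p, j, h1, h2, h3, h4, h5⟩ := h
    exact ⟨P, p, h1, h2, ppd_equiv ((LinearEquiv.ofInjective j h3).trans
      (LinearEquiv.ofEq _ _ h4)) h5⟩
  · rintro ⟨P, p, h1, h2, h3⟩
    unfold PureProjDimLE
    exact ⟨P, ModuleCat.of A (LinearMap.ker p), p, (LinearMap.ker p).subtype, h1, h2,
      Subtype.val_injective, by simp, h3⟩

theorem pp_fp {A : Type u} [Ring A] {M : Type u} [AddCommGroup M] [Module A M]
    (h : Module.FinitePresentation A M) : IsPureProjective A M := by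
  refine ⟨PUnit, fun _ => ModuleCat.of A M, fun _ => h,
    DirectSum.lof A PUnit (fun _ => M) PUnit.unit,
    DirectSum.component A PUnit (fun _ => M) PUnit.unit, ?_⟩
  ext x
  simp

theorem ppd_mono {A : Type u} [Ring A] {n : ℕ} : ∀ {M : Type u} [AddCommGroup M] [Module A M],
    PureProjDimLE A n M → PureProjDimLE A (n + 1) M := by
  induction n with
  | zero =>
    intro M _ _ h
    unfold PureProjDimLE at h
    refine ppd_succ_iff.2 ⟨ModuleCat.of A M, LinearMap.id, h,
      pe_of_lift _ fun F _ g => ⟨g, fun x => rfl⟩, ?_⟩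
    unfold PureProjDimLE
    have : Subsingleton (LinearMap.ker (LinearMap.id : M →ₗ[A] M)) := by
      rw [LinearMap.ker_id]; infer_instance
    exact pp_fp inferInstance
  | succ n ih =>
    intro M _ _ h
    obtain ⟨P, p, h1, h2, h3⟩ := ppd_succ_iff.1 h
    exact ppd_succ_iff.2 ⟨P, p, h1, h2, ih h3⟩

open Classical in
theorem pp_lift {A : Type u} [Ring A] {P B C : Type u} [AddCommGroup P] [Module A P]
    [AddCommGroup B] [Module A B] [AddCommGroup C] [Module A C] (h : IsPureProjective A P)
    {p : B →ₗ[A] C} (hp : IsPureEpi A p) (g : P →ₗ[A] C) : ∃ f : P →ₗ[A] B, p ∘ₗ f = g := by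
  obtain ⟨κ, F, hF, s, r, hrs⟩ := h
  choose f hf using fun i => hp.2 (F i) (hF i) (g ∘ₗ r ∘ₗ DirectSum.lof A κ (fun i => F i) i)
  refine ⟨DirectSum.toModule A κ B f ∘ₗ s, ?_⟩
  have : p ∘ₗ DirectSum.toModule A κ B f = g ∘ₗ r := by
    apply DirectSum.linearMap_ext
    intro i
    ext x
    simpa using LinearMap.congr_fun (hf i) x
  rw [← LinearMap.comp_assoc, this, LinearMap.comp_assoc, hrs, LinearMap.comp_id]

open Classical in
theorem pp_sum {A : Type u} [Ring A] {ι : Type u} (P : ι → ModuleCat.{u} A)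
    (h : ∀ i, IsPureProjective A (P i)) : IsPureProjective A (⨁ i, (P i : Type u)) := by
  choose κ F hF s r hrs using h
  refine ⟨Σ i, κ i, fun x => F x.1 x.2, fun x => hF _ _,
    DirectSum.toModule A ι _ (fun i => (DirectSum.toModule A (κ i) _ (fun k =>
      DirectSum.lof A (Σ i, κ i) (fun x => F x.1 x.2) ⟨i, k⟩)) ∘ₗ s i),
    DirectSum.toModule A _ _ (fun x => DirectSum.lof A ι (fun i => P i) x.1 ∘ₗ r x.1 ∘ₗ
      DirectSum.lof A (κ x.1) (fun k => F x.1 k) x.2), ?_⟩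
  apply DirectSum.linearMap_ext
  intro i
  have key : (DirectSum.toModule A (Σ i, κ i) _ (fun x => DirectSum.lof A ι (fun i => P i) x.1 ∘ₗ
      r x.1 ∘ₗ DirectSum.lof A (κ x.1) (fun k => F x.1 k) x.2)) ∘ₗ
      (DirectSum.toModule A (κ i) _ (fun k =>
      DirectSum.lof A (Σ i, κ i) (fun x => F x.1 x.2) ⟨i, k⟩)) =
      DirectSum.lof A ι (fun i => P i) i ∘ₗ r i := by
    apply DirectSum.linearMap_ext
    intro k
    ext x : 1
    simp only [LinearMap.comp_apply, DirectSum.toModule_lof]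
  ext x : 1
  have h1 := LinearMap.congr_fun key (s i x)
  have h2 := LinearMap.congr_fun (hrs i) x
  simp only [LinearMap.comp_apply, DirectSum.toModule_lof, LinearMap.id_apply] at h1 h2 ⊢
  rw [h1, h2]

/-- Elements of a direct sum supported on indices at most `i`. -/
def suppLE (A : Type u) [Ring A] {ι : Type u} [LinearOrder ι] (P : ι → ModuleCat.{u} A) (i : ι) :
    Submodule A (⨁ i, (P i : Type u)) where
  carrier := {x | ∀ j, i < j → x j = 0}
  add_mem' := fun ha hb j hj => by simp [ha j hj, hb j hj]
  zero_mem' := fun j _ => rfl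
  smul_mem' := fun c x hx j hj => by simp [DirectSum.smul_apply, hx j hj]

open Classical in
theorem exists_top {A : Type u} [Ring A] {ι : Type u} [LinearOrder ι] (P : ι → ModuleCat.{u} A)
    (y : ⨁ i, (P i : Type u)) : y = 0 ∨ ∃ j, y j ≠ 0 ∧ y ∈ suppLE A P j := by
  by_cases h : y = 0
  · exact Or.inl h
  right
  have hne : (DFinsupp.support y).Nonempty := by
    rw [Finset.nonempty_iff_ne_empty]
    intro h'
    exact h (DFinsupp.support_eq_empty.1 h')
  refine ⟨(DFinsupp.support y).max' hne, ?_, fun l hl => ?_⟩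
  · exact DFinsupp.mem_support_iff.1 (Finset.max'_mem _ hne)
  · by_contra hc
    exact absurd (Finset.le_max' _ l (DFinsupp.mem_support_iff.2 hc)) (not_le.2 hl)

theorem exists_lt {A : Type u} [Ring A] {ι : Type u} [LinearOrder ι] (P : ι → ModuleCat.{u} A)
    (i : ι) (y : ⨁ i, (P i : Type u)) (hy : y ∈ suppLE A P i) (hi : y i = 0) :
    y = 0 ∨ ∃ j < i, y ∈ suppLE A P j := by
  rcases exists_top P y with h | ⟨j, hj, h⟩
  · exact Or.inl h
  refine Or.inr ⟨j, ?_, h⟩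
  by_contra hc
  rcases (not_lt.1 hc).eq_or_lt with rfl | h'
  · exact hj hi
  · exact hj (hy j h')

theorem fg_chain {A : Type u} [Ring A] {ι : Type u} [LinearOrder ι] {K F : Type u}
    [AddCommGroup K] [Module A K] [AddCommGroup F] [Module A F] [Module.Finite A F]
    (L : ι → Submodule A K) (hL : Monotone L) (S : ι → Prop) (g : F →ₗ[A] K)
    (hg : ∀ x, g x = 0 ∨ ∃ j, S j ∧ g x ∈ L j) : g = 0 ∨ ∃ j, S j ∧ ∀ x, g x ∈ L j := by
  classical
  obtain ⟨s, hs⟩ := (Module.Finite.fg_top : (⊤ : Submodule A F).FG)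
  have key : ∀ t : Finset F, (∀ x ∈ t, g x = 0) ∨ ∃ j, S j ∧ ∀ x ∈ t, g x ∈ L j := by
    intro t
    induction t using Finset.induction_on with
    | empty => left; simp
    | insert a t _ ih =>
      rcases hg a with h0 | ⟨j, hj, h0⟩ <;> rcases ih with h1 | ⟨l, hl, h1⟩
      · left; intro x hx
        rcases Finset.mem_insert.1 hx with rfl | hx
        exacts [h0, h1 x hx]
      · right; refine ⟨l, hl, fun x hx => ?_⟩
        rcases Finset.mem_insert.1 hx with rfl | hx
        exacts [h0 ▸ zero_mem _, h1 x hx]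
      · right; refine ⟨j, hj, fun x hx => ?_⟩
        rcases Finset.mem_insert.1 hx with rfl | hx
        exacts [h0, (h1 x hx) ▸ zero_mem _]
      · right; refine ⟨max j l, ?_, fun x hx => ?_⟩
        · rcases max_choice j l with h | h <;> rw [h] <;> assumption
        rcases Finset.mem_insert.1 hx with rfl | hx
        exacts [hL (le_max_left _ _) h0, hL (le_max_right _ _) (h1 x hx)]
  rcases key s with h | ⟨j, hj, h⟩
  · left
    have : ⊤ ≤ LinearMap.ker g := by
      rw [← hs, Submodule.span_le]; exact h
    ext x; exact this (Submodule.mem_top (x := x))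
  · right
    have : ⊤ ≤ (L j).comap g := by
      rw [← hs, Submodule.span_le]; exact h
    exact ⟨j, hj, fun x => this (Submodule.mem_top (x := x))⟩

open Classical in
theorem sum_mem_L {A : Type u} [Ring A] {ι : Type u} [LinearOrder ι] {K : Type u}
    [AddCommGroup K] [Module A K] (L : ι → Submodule A K) (hL : Monotone L)
    (P : ι → ModuleCat.{u} A) (f : ∀ i, (P i : Type u) →ₗ[A] L i) (i : ι)
    (y : ⨁ i, (P i : Type u)) (hy : y ∈ suppLE A P i) :
    DirectSum.toModule A ι K (fun i => (L i).subtype ∘ₗ f i) y ∈ L i := by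
  rw [← DirectSum.sum_support_of y, map_sum]
  refine Submodule.sum_mem _ fun j hj => ?_
  have hji : j ≤ i := by
    by_contra hc
    exact (DFinsupp.mem_support_iff.1 hj) (hy j (not_le.1 hc))
  have := DirectSum.toModule_lof A (φ := fun i => (L i).subtype ∘ₗ f i) j (y j)
  rw [DirectSum.lof_eq_of] at this
  rw [this]
  exact hL hji (f j (y j)).2

open Classical in
/-- The component at `i` of an element supported on `≤ i` whose sum is zero. -/
theorem comp_mem {A : Type u} [Ring A] {ι : Type u} [LinearOrder ι] {K : Type u}
    [AddCommGroup K] [Module A K] (L : ι → Submodule A K) (hL : Monotone L)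
    (P : ι → ModuleCat.{u} A) (f : ∀ i, (P i : Type u) →ₗ[A] L i) (i : ι)
    (y : ⨁ i, (P i : Type u)) (hy : y ∈ suppLE A P i)
    (h0 : DirectSum.toModule A ι K (fun i => (L i).subtype ∘ₗ f i) y = 0) :
    (f i (y i) : K) = 0 ∨ ∃ j < i, (f i (y i) : K) ∈ L j := by
  set z := y - DirectSum.lof A ι (fun i => (P i : Type u)) i (y i) with hz
  have hzi : z i = 0 := by
    simp [hz, DirectSum.sub_apply, DirectSum.lof_eq_of, DirectSum.of_eq_same]
  have hzs : z ∈ suppLE A P i := by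
    intro j hj
    rw [hz, DirectSum.sub_apply, hy j hj, DirectSum.lof_eq_of, DirectSum.of_eq_of_ne _ _ _ hj.ne']
    simp
  have hs : (f i (y i) : K) = - DirectSum.toModule A ι K (fun i => (L i).subtype ∘ₗ f i) z := by
    rw [hz, map_sub, h0, DirectSum.toModule_lof]; simp
  rcases exists_lt P i z hzs hzi with h | ⟨j, hj, h⟩
  · left; rw [hs, h]; simp
  · right; exact ⟨j, hj, by rw [hs]; exact neg_mem (sum_mem_L L hL P f j z h)⟩

open Classical in
theorem lof_mem {A : Type u} [Ring A] {ι : Type u} [LinearOrder ι]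
    (P : ι → ModuleCat.{u} A) (i : ι) (a : P i) :
    DirectSum.lof A ι (fun i => (P i : Type u)) i a ∈ suppLE A P i := by
  intro j hj
  rw [DirectSum.lof_eq_of, DirectSum.of_eq_of_ne _ _ _ hj.ne']

theorem suppLE_mono {A : Type u} [Ring A] {ι : Type u} [LinearOrder ι]
    (P : ι → ModuleCat.{u} A) : Monotone (suppLE A P) :=
  fun _ _ hij _ hx l hl => hx l (hij.trans_lt hl)

open Classical in
theorem lift_core {A : Type u} [Ring A] {ι : Type u} [LinearOrder ι] [WellFoundedLT ι] {K : Type u}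
    [AddCommGroup K] [Module A K] (L : ι → Submodule A K) (hL : Monotone L)
    (Q : ι → ModuleCat.{u} A) (q : ∀ i, L i →ₗ[A] Q i)
    (hker : ∀ i (x : L i), q i x = 0 ↔ (x : K) = 0 ∨ ∃ j < i, (x : K) ∈ L j)
    (P : ι → ModuleCat.{u} A) (f : ∀ i, (P i : Type u) →ₗ[A] L i)
    (hp : ∀ i, IsPureEpi A (q i ∘ₗ f i))
    (F : ModuleCat.{u} A) (hF : Module.FinitePresentation A F) (i : ι) :
    ∀ g : (F : Type u) →ₗ[A] K, (∀ x, g x ∈ L i) →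
      ∃ h : (F : Type u) →ₗ[A] (⨁ i, (P i : Type u)),
        ∀ x, DirectSum.toModule A ι K (fun i => (L i).subtype ∘ₗ f i) (h x) = g x ∧
          h x ∈ suppLE A P i := by
  induction i using WellFoundedLT.induction with
  | ind i ih =>
    intro g hg
    obtain ⟨h1, hh1⟩ := (hp i).2 F hF (q i ∘ₗ g.codRestrict (L i) hg)
    set g' : (F : Type u) →ₗ[A] K := g - (L i).subtype ∘ₗ f i ∘ₗ h1 with hg'
    have hz : ∀ x, g' x = 0 ∨ ∃ j, j < i ∧ g' x ∈ L j := by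
      intro x
      have := (hker i (g.codRestrict (L i) hg x - f i (h1 x))).1 (by
        have := LinearMap.congr_fun hh1 x
        simp only [LinearMap.comp_apply] at this
        rw [map_sub, this, sub_self])
      simpa [hg'] using this
    have hsum : ∀ x, g x = g' x + f i (h1 x) := fun x => by simp [hg']
    have : Module.Finite A F := inferInstance
    rcases fg_chain L hL (fun j => j < i) g' hz with h0 | ⟨j, hj, h0⟩
    · refine ⟨DirectSum.lof A ι (fun i => (P i : Type u)) i ∘ₗ h1, fun x => ⟨?_, lof_mem P i _⟩⟩
      rw [hsum, h0]
      simp [DirectSum.toModule_lof]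
    · obtain ⟨h2, hh2⟩ := ih j hj g' h0
      refine ⟨h2 + DirectSum.lof A ι (fun i => (P i : Type u)) i ∘ₗ h1, fun x =>
        ⟨?_, add_mem (suppLE_mono P hj.le (hh2 x).2) (lof_mem P i _)⟩⟩
      rw [hsum, ← (hh2 x).1]
      simp [DirectSum.toModule_lof]

open Classical in
theorem sum_pe {A : Type u} [Ring A] {ι : Type u} [LinearOrder ι] [WellFoundedLT ι] {K : Type u}
    [AddCommGroup K] [Module A K] (L : ι → Submodule A K) (hL : Monotone L)
    (htop : ∀ x : K, x = 0 ∨ ∃ i, x ∈ L i)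
    (Q : ι → ModuleCat.{u} A) (q : ∀ i, L i →ₗ[A] Q i)
    (hker : ∀ i (x : L i), q i x = 0 ↔ (x : K) = 0 ∨ ∃ j < i, (x : K) ∈ L j)
    (P : ι → ModuleCat.{u} A) (f : ∀ i, (P i : Type u) →ₗ[A] L i)
    (hp : ∀ i, IsPureEpi A (q i ∘ₗ f i)) :
    IsPureEpi A (DirectSum.toModule A ι K (fun i => (L i).subtype ∘ₗ f i)) := by
  refine pe_of_lift _ fun F hF g => ?_
  have : Module.Finite A F := inferInstance
  rcases fg_chain L hL (fun _ => True) g (by simpa using fun x => htop (g x)) with h | ⟨j, -, h⟩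
  · exact ⟨0, fun x => by simp [h]⟩
  · obtain ⟨h', hh'⟩ := lift_core L hL Q q hker P f hp F hF j g h
    exact ⟨h', fun x => (hh' x).1⟩

theorem filt {A : Type u} [Ring A] {ι : Type u} [LinearOrder ι] [WellFoundedLT ι] (n : ℕ) :
    ∀ {K : Type u}
    [AddCommGroup K] [Module A K] (L : ι → Submodule A K) (_ : Monotone L)
    (_ : ∀ x : K, x = 0 ∨ ∃ i, x ∈ L i)
    (Q : ι → ModuleCat.{u} A) (q : ∀ i, L i →ₗ[A] Q i) (_ : ∀ i, IsPureEpi A (q i))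
    (_ : ∀ i (x : L i), q i x = 0 ↔ (x : K) = 0 ∨ ∃ j < i, (x : K) ∈ L j)
    (_ : ∀ i, PureProjDimLE A n (Q i)), PureProjDimLE A n K := by
  classical
  induction n with
  | zero =>
    intro K _ _ L hL htop Q q hq hker hQ
    unfold PureProjDimLE at hQ ⊢
    choose f hf using fun i => pp_lift (hQ i) (hq i) LinearMap.id
    have hpe := sum_pe L hL htop Q q hker Q f (fun i => by
      rw [hf]; exact pe_of_equiv (LinearEquiv.refl A _))
    set Φ := DirectSum.toModule A ι K (fun i => (L i).subtype ∘ₗ f i) with hΦ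
    have hinj : Function.Injective Φ := by
      rw [← LinearMap.ker_eq_bot, LinearMap.ker_eq_bot']
      intro y hy
      rcases exists_top Q y with h | ⟨j, hj, h⟩
      · exact h
      · exfalso
        have := (hker j (f j (y j))).2 (comp_mem L hL Q f j y h hy)
        have h2 := LinearMap.congr_fun (hf j) (y j)
        simp only [LinearMap.comp_apply, LinearMap.id_apply] at h2
        exact hj (h2.symm.trans this)
    let e := LinearEquiv.ofBijective Φ ⟨hinj, hpe.1⟩
    exact pp_retract (pp_sum Q hQ) e.symm.toLinearMap e.toLinearMap (by simp)
  | succ n ih =>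
    intro K _ _ L hL htop Q q hq hker hQ
    choose P p hP hp hK using fun i => ppd_succ_iff.1 (hQ i)
    choose f hf using fun i => pp_lift (hP i) (hq i) (p i)
    have hp' : ∀ i, IsPureEpi A (q i ∘ₗ f i) := fun i => by rw [hf]; exact hp i
    have hpe := sum_pe L hL htop Q q hker P f hp'
    have hcore := lift_core L hL Q q hker P f hp'
    have hcomp := comp_mem L hL P f
    set Φ := DirectSum.toModule A ι K (fun i => (L i).subtype ∘ₗ f i) with hΦ
    refine ppd_succ_iff.2 ⟨ModuleCat.of A (⨁ i, (P i : Type u)), Φ, pp_sum P hP, hpe, ?_⟩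
    have hqf : ∀ i x, q i (f i x) = p i x := fun i x => LinearMap.congr_fun (hf i) x
    let LN : ι → Submodule A (LinearMap.ker Φ) := fun i =>
      (suppLE A P i).comap (LinearMap.ker Φ).subtype
    let q' : ∀ i, LN i →ₗ[A] LinearMap.ker (p i) := fun i =>
      LinearMap.codRestrict _ (DirectSum.component A ι (fun i => (P i : Type u)) i ∘ₗ
        (LinearMap.ker Φ).subtype ∘ₗ (LN i).subtype) (fun x => by
          have := (hker i _).2 (hcomp i x.1.1 x.2 x.1.2)
          rw [hqf] at this
          exact this)
    have hq'v : ∀ i x, (q' i x : P i) = x.1.1 i := fun i x => rfl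
    refine ih LN (fun i j hij x hx => suppLE_mono P hij hx) (fun x => ?_)
      (fun i => ModuleCat.of A (LinearMap.ker (p i))) q' (fun i => ?_) (fun i x => ?_) hK
    · rcases exists_top P x.1 with h | ⟨j, -, h⟩
      · exact Or.inl (Subtype.ext h)
      · exact Or.inr ⟨j, h⟩
    · refine pe_of_lift _ fun F hF g => ?_
      have hfin : Module.Finite A F := inferInstance
      let g0 : (F : Type u) →ₗ[A] P i := (LinearMap.ker (p i)).subtype ∘ₗ g
      let g' : (F : Type u) →ₗ[A] K := (L i).subtype ∘ₗ f i ∘ₗ g0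
      have hz : ∀ x, g' x = 0 ∨ ∃ j, j < i ∧ g' x ∈ L j := fun x =>
        (hker i (f i (g0 x))).1 (by rw [hqf]; exact (g x).2)
      have hex : ∃ h : (F : Type u) →ₗ[A] (⨁ i, (P i : Type u)),
          ∀ x, Φ (h x) = g' x ∧ h x ∈ suppLE A P i ∧ h x i = 0 := by
        rcases fg_chain L hL (fun j => j < i) g' hz with h0 | ⟨j, hj, h0⟩
        · exact ⟨0, fun x => ⟨by simp [h0], zero_mem _, rfl⟩⟩
        · obtain ⟨h, hh⟩ := hcore F hF j g' h0
          exact ⟨h, fun x => ⟨(hh x).1, suppLE_mono P hj.le (hh x).2, (hh x).2 i hj⟩⟩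
      obtain ⟨h, hh⟩ := hex
      let w : (F : Type u) →ₗ[A] (⨁ i, (P i : Type u)) :=
        DirectSum.lof A ι (fun i => (P i : Type u)) i ∘ₗ g0 - h
      have hw1 : ∀ x, w x ∈ LinearMap.ker Φ := fun x => by
        rw [LinearMap.mem_ker]
        change Φ (DirectSum.lof A ι (fun i => (P i : Type u)) i (g0 x) - h x) = 0
        rw [map_sub, (hh x).1, hΦ, DirectSum.toModule_lof]
        exact sub_self _
      have hw2 : ∀ x, w x ∈ suppLE A P i := fun x => sub_mem (lof_mem P i _) (hh x).2.1
      refine ⟨(w.codRestrict _ hw1).codRestrict (LN i) hw2, fun x => Subtype.ext ?_⟩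
      rw [hq'v]
      change w x i = g0 x
      simp only [w, LinearMap.sub_apply, DirectSum.sub_apply, (hh x).2.2, LinearMap.comp_apply,
        DirectSum.lof_eq_of, DirectSum.of_eq_same, sub_zero]
    · constructor
      · intro h
        have h' : x.1.1 i = 0 := by rw [← hq'v, h]; rfl
        rcases exists_lt P i x.1.1 x.2 h' with h | h
        · exact Or.inl (Subtype.ext h)
        · exact Or.inr h
      · intro h
        apply Subtype.ext
        rw [hq'v]
        rcases h with h | ⟨j, hj, h⟩
        · rw [h]; rfl
        · exact h i hj

theorem ppd_ext {A : Type u} [Ring A] {n : ℕ} {B C : Type u} [AddCommGroup B] [Module A B]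
    [AddCommGroup C] [Module A C] (p : B →ₗ[A] C) (hp : IsPureEpi A p)
    (h1 : PureProjDimLE A n (LinearMap.ker p)) (h2 : PureProjDimLE A n C) :
    PureProjDimLE A n B := by
  let L : ULift.{u} Bool → Submodule A B := fun i => match i with
    | ⟨true⟩ => ⊤
    | ⟨false⟩ => LinearMap.ker p
  let Q : ULift.{u} Bool → ModuleCat.{u} A := fun i => match i with
    | ⟨true⟩ => ModuleCat.of A C
    | ⟨false⟩ => ModuleCat.of A (LinearMap.ker p)
  let q : ∀ i, L i →ₗ[A] Q i := fun i => match i with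
    | ⟨true⟩ => p ∘ₗ (⊤ : Submodule A B).subtype
    | ⟨false⟩ => (LinearMap.id : LinearMap.ker p →ₗ[A] LinearMap.ker p)
  haveI : WellFoundedLT (ULift.{u} Bool) := Finite.to_wellFoundedLT
  have hft : (⟨false⟩ : ULift.{u} Bool) < ⟨true⟩ := by
    exact (by decide : (false : Bool) < true)
  refine filt (ι := ULift.{u} Bool) n L ?_ (fun x => Or.inr ⟨⟨true⟩, trivial⟩) Q q ?_ ?_ ?_
  · rintro ⟨_ | _⟩ ⟨_ | _⟩ h
    · exact le_rfl
    · exact le_top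
    · exact absurd h (not_le.2 hft)
    · exact le_rfl
  · rintro ⟨_ | _⟩
    · exact pe_of_equiv (LinearEquiv.refl A _)
    · exact pe_equiv (pe_of_equiv (Submodule.topEquiv (R := A) (M := B))) hp
  · rintro ⟨_ | _⟩ x
    · constructor
      · intro h; left; exact congrArg Subtype.val h
      · rintro (h | ⟨⟨_ | _⟩, hj, h⟩)
        · exact Subtype.ext h
        · exact absurd hj (lt_irrefl _)
        · exact absurd hj (not_lt.2 hft.le)
    · constructor
      · intro h; right; exact ⟨⟨false⟩, hft, h⟩
      · rintro (h | ⟨⟨_ | _⟩, hj, h⟩)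
        · change p x.1 = 0
          rw [h, map_zero]
        · exact h
        · exact absurd hj (lt_irrefl _)
  · rintro ⟨_ | _⟩
    · exact h1
    · exact h2

theorem ppd_sum {A : Type u} [Ring A] {ι : Type u} [LinearOrder ι] [WellFoundedLT ι] {n : ℕ}
    (P : ι → ModuleCat.{u} A)
    (h : ∀ i, PureProjDimLE A n (P i)) : PureProjDimLE A n (⨁ i, (P i : Type u)) := by
  classical
  refine filt n (suppLE A P) (suppLE_mono P) (fun x => ?_) P
    (fun i => DirectSum.component A ι (fun i => (P i : Type u)) i ∘ₗ (suppLE A P i).subtype)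
    (fun i => ?_) (fun i x => ⟨fun h => exists_lt P i x.1 x.2 h, ?_⟩) h
  · rcases exists_top P x with h | ⟨j, -, h⟩
    · exact Or.inl h
    · exact Or.inr ⟨j, h⟩
  · refine pe_of_lift _ fun F hF g => ⟨LinearMap.codRestrict _
      (DirectSum.lof A ι (fun i => (P i : Type u)) i ∘ₗ g) (fun x => lof_mem P i _), fun x => ?_⟩
    simp
  · rintro (h | ⟨j, hj, h⟩)
    · change x.1 i = 0
      rw [h]; rfl
    · exact h i hj

theorem ppd_quot {A : Type u} [Ring A] {n : ℕ} {B C : Type u} [AddCommGroup B] [Module A B]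
    [AddCommGroup C] [Module A C] (p : B →ₗ[A] C) (hp : IsPureEpi A p)
    (h1 : PureProjDimLE A n (LinearMap.ker p)) (h2 : PureProjDimLE A n B) :
    PureProjDimLE A (n + 1) C := by
  cases n with
  | zero =>
    unfold PureProjDimLE at h2
    exact ppd_succ_iff.2 ⟨ModuleCat.of A B, p, h2, hp, h1⟩
  | succ n =>
    obtain ⟨P, r, hP, hr, hk⟩ := ppd_succ_iff.1 h2
    refine ppd_succ_iff.2 ⟨P, p ∘ₗ r, hP, pe_equiv hr hp, ?_⟩
    let r' : LinearMap.ker (p ∘ₗ r) →ₗ[A] LinearMap.ker p :=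
      LinearMap.codRestrict _ (r ∘ₗ (LinearMap.ker (p ∘ₗ r)).subtype) (fun x => x.2)
    refine ppd_ext r' (pe_of_lift _ fun F hF g => ?_) ?_ h1
    · obtain ⟨h, hh⟩ := hr.2 F hF ((LinearMap.ker p).subtype ∘ₗ g)
      have hh' : ∀ x, r (h x) = g x := fun x => LinearMap.congr_fun hh x
      refine ⟨h.codRestrict _ (fun x => ?_), fun x => Subtype.ext (hh' x)⟩
      rw [LinearMap.mem_ker, LinearMap.comp_apply, hh']
      exact (g x).2
    · refine ppd_mono (ppd_equiv ?_ hk)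
      refine LinearEquiv.ofBijective (LinearMap.codRestrict (LinearMap.ker r')
        (LinearMap.codRestrict (LinearMap.ker (p ∘ₗ r)) (LinearMap.ker r).subtype (fun x => ?_))
        (fun x => ?_)) ⟨fun x y hxy => ?_, fun y => ?_⟩
      · have : r x.1 = 0 := x.2
        change p (r x.1) = 0
        rw [this, map_zero]
      · exact Subtype.ext x.2
      · exact Subtype.ext (congrArg (fun z => z.1.1) hxy)
      · exact ⟨⟨y.1.1, congrArg Subtype.val y.2⟩, rfl⟩

theorem step {A : Type u} [Ring A] {ι : Type u} [LinearOrder ι] [WellFoundedLT ι] {n : ℕ}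
    {M : Type u} [AddCommGroup M] [Module A M] (L L' : ι → Submodule A M) (hL : Monotone L)
    (htop : ∀ x : M, x = 0 ∨ ∃ i, x ∈ L i)
    (hL' : ∀ i x, x ∈ L' i ↔ x = 0 ∨ ∃ j < i, x ∈ L j)
    (h : ∀ i, PureProjDimLE A n (L i)) (h' : ∀ i, PureProjDimLE A n (L' i)) :
    PureProjDimLE A (n + 1) M := by
  classical
  obtain ⟨P, e⟩ : Σ' P : ι → ModuleCat.{u} A, ∀ i, (P i : Type u) ≃ₗ[A] L i :=
    ⟨fun i => ModuleCat.of A (L i), fun i => LinearEquiv.refl A _⟩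
  let f : ∀ i, (P i : Type u) →ₗ[A] L i := fun i => (e i).toLinearMap
  have hcomp := comp_mem L hL P f
  set Φ : (⨁ i, (P i : Type u)) →ₗ[A] M :=
    DirectSum.toModule A ι M (fun i => (L i).subtype ∘ₗ f i) with hΦ
  have hΦl : ∀ i a, Φ (DirectSum.lof A ι (fun i => (P i : Type u)) i a) = (e i a).1 := fun i a => by
    rw [hΦ, DirectSum.toModule_lof]; rfl
  have hfg : ∀ (F : ModuleCat.{u} A), Module.FinitePresentation A F →
      ∀ (S : ι → Prop) (g : (F : Type u) →ₗ[A] M), (∀ x, g x = 0 ∨ ∃ j, S j ∧ g x ∈ L j) →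
      ∃ u : (F : Type u) →ₗ[A] (⨁ i, (P i : Type u)), (∀ x, Φ (u x) = g x) ∧
        (u = 0 ∨ ∃ j, S j ∧ ∀ x, u x ∈ suppLE A P j) := by
    intro F hF S g hg
    have : Module.Finite A F := inferInstance
    rcases fg_chain L hL S g hg with h0 | ⟨j, hj, h0⟩
    · exact ⟨0, fun x => by simp [h0], Or.inl rfl⟩
    · exact ⟨DirectSum.lof A ι (fun i => (P i : Type u)) j ∘ₗ
        (e j).symm.toLinearMap ∘ₗ g.codRestrict (L j) h0,
        fun x => (hΦl _ _).trans (by simp), Or.inr ⟨j, hj, fun x => lof_mem P j _⟩⟩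
  have hpe : IsPureEpi A Φ := by
    refine pe_of_lift _ fun F hF g => ?_
    obtain ⟨u, hu, -⟩ := hfg F hF (fun _ => True) g (by simpa using fun x => htop (g x))
    exact ⟨u, hu⟩
  refine ppd_quot Φ hpe ?_ (ppd_sum P fun i => ppd_equiv (e i).symm (h i))
  let LN : ι → Submodule A (LinearMap.ker Φ) := fun i =>
    (suppLE A P i).comap (LinearMap.ker Φ).subtype
  let q' : ∀ i, LN i →ₗ[A] L' i := fun i =>
    LinearMap.codRestrict _ ((L i).subtype ∘ₗ f i ∘ₗ
      DirectSum.component A ι (fun i => (P i : Type u)) i ∘ₗ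
      (LinearMap.ker Φ).subtype ∘ₗ (LN i).subtype)
      (fun x => (hL' i _).2 (hcomp i x.1.1 x.2 x.1.2))
  have hq'v : ∀ i x, (q' i x : M) = (e i (x.1.1 i)).1 := fun i x => rfl
  refine filt n LN (fun i j hij x hx => suppLE_mono P hij hx) (fun x => ?_)
      (fun i => ModuleCat.of A (L' i)) q' (fun i => ?_) (fun i x => ?_) h'
  · rcases exists_top P x.1 with h | ⟨j, -, h⟩
    · exact Or.inl (Subtype.ext h)
    · exact Or.inr ⟨j, h⟩
  · have hle : L' i ≤ L i := fun x hx => by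
      rcases (hL' i x).1 hx with h | ⟨j, hj, h⟩
      · rw [h]; exact zero_mem _
      · exact hL hj.le h
    refine pe_of_lift _ fun F hF g => ?_
    obtain ⟨v, hv, hv'⟩ := hfg F hF (fun j => j < i) ((L' i).subtype ∘ₗ g)
      (fun x => (hL' i _).1 (g x).2)
    have hv2 : ∀ x, v x ∈ suppLE A P i ∧ v x i = 0 := by
      intro x
      rcases hv' with h | ⟨j, hj, h⟩
      · rw [h]; exact ⟨zero_mem _, rfl⟩
      · exact ⟨suppLE_mono P hj.le (h x), h x i hj⟩
    let g0 : (F : Type u) →ₗ[A] P i := (e i).symm.toLinearMap ∘ₗ Submodule.inclusion hle ∘ₗ g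
    let w : (F : Type u) →ₗ[A] (⨁ i, (P i : Type u)) :=
        DirectSum.lof A ι (fun i => (P i : Type u)) i ∘ₗ g0 - v
    have hw1 : ∀ x, w x ∈ LinearMap.ker Φ := fun x => by
      rw [LinearMap.mem_ker]
      change Φ (DirectSum.lof A ι (fun i => (P i : Type u)) i (g0 x) - v x) = 0
      rw [map_sub, hv, hΦl]
      simp [g0]
    have hw2 : ∀ x, w x ∈ suppLE A P i := fun x => sub_mem (lof_mem P i _) (hv2 x).1
    refine ⟨(w.codRestrict _ hw1).codRestrict (LN i) hw2, fun x => Subtype.ext ?_⟩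
    rw [hq'v]
    have hwx : w x i = g0 x := by
      simp only [w, LinearMap.sub_apply, DirectSum.sub_apply, (hv2 x).2, LinearMap.comp_apply,
        DirectSum.lof_eq_of, DirectSum.of_eq_same, sub_zero]
    change (e i (w x i)).1 = (g x).1
    rw [hwx]
    simp [g0]
  · constructor
    · intro h
      have h' : x.1.1 i = 0 := (e i).map_eq_zero_iff.1 (Subtype.ext (by
        rw [← hq'v, h]; rfl))
      rcases exists_lt P i x.1.1 x.2 h' with h | h
      · exact Or.inl (Subtype.ext h)
      · exact Or.inr h
    · intro h
      apply Subtype.ext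
      rw [hq'v]
      have : x.1.1 i = 0 := by
        rcases h with h | ⟨j, hj, h⟩
        · rw [h]; rfl
        · exact h i hj
      rw [this, map_zero]; rfl

theorem main_card {A : Type u} [Ring A] [IsNoetherianRing A] (n : ℕ) :
    ∀ {M : Type u} [AddCommGroup M] [Module A M] (S : Set M), Submodule.span A S = ⊤ →
      Cardinal.mk S < Cardinal.aleph n → PureProjDimLE A n M := by
  induction n with
  | zero =>
    intro M _ _ S hS hc
    unfold PureProjDimLE
    have hfin : S.Finite := by
      rw [← Cardinal.lt_aleph0_iff_set_finite]
      simpa using hc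
    have : Module.Finite A M := ⟨⟨hfin.toFinset, by simpa using hS⟩⟩
    exact pp_fp (Module.finitePresentation_of_finite A M)
  | succ n ih =>
    intro M _ _ S hS hc
    have hc' : Cardinal.mk S ≤ Cardinal.aleph n := by
      have : ((n + 1 : ℕ) : Ordinal) = Order.succ (n : Ordinal) := by simp
      rw [this, Cardinal.aleph_succ] at hc
      exact Order.lt_succ_iff.1 hc
    let ι := (Cardinal.mk S).ord.ToType
    have hι : Cardinal.mk ι = Cardinal.mk S := by simp [ι]
    obtain ⟨e⟩ := Cardinal.eq.1 hι
    let b : ι → M := fun i => (e i : M)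
    have hb : Set.range b = S := by
      ext x; constructor
      · rintro ⟨i, rfl⟩; exact (e i).2
      · intro hx; exact ⟨e.symm ⟨x, hx⟩, by simp [b]⟩
    have hIio : ∀ i : ι, Cardinal.mk (Set.Iio i) < Cardinal.aleph n := fun i =>
      (Cardinal.mk_Iio_ord_toType i).trans_le hc'
    have hIic : ∀ i : ι, Cardinal.mk (Set.Iic i) < Cardinal.aleph n := fun i => by
      rw [← Set.Iio_insert]
      refine (Cardinal.mk_insert_le).trans_lt ?_
      exact Cardinal.add_lt_of_lt (Cardinal.aleph0_le_aleph _) (hIio i)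
        (Cardinal.one_lt_aleph0.trans_le (Cardinal.aleph0_le_aleph _))
    have gen : ∀ T : Set ι, Cardinal.mk T < Cardinal.aleph n →
        PureProjDimLE A n (Submodule.span A (b '' T)) := by
      intro T hT
      refine ih (((↑) : Submodule.span A (b '' T) → M) ⁻¹' (b '' T))
        (Submodule.span_span_coe_preimage) ?_
      refine (Cardinal.mk_preimage_of_injective _ _ Subtype.val_injective).trans_lt ?_
      exact Cardinal.mk_image_le.trans_lt hT
    have hmono : Monotone fun i => Submodule.span A (b '' Set.Iic i) := fun i j hij =>
      Submodule.span_mono (Set.image_mono (Set.Iic_subset_Iic.2 hij))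
    -- the span of a family is the directed union of the partial spans
    have hunion : ∀ (T : Set ι), ∀ x ∈ Submodule.span A (b '' T),
        x = 0 ∨ ∃ j ∈ T, x ∈ Submodule.span A (b '' Set.Iic j) := by
      intro T x hx
      induction hx using Submodule.span_induction with
      | mem x hx =>
        obtain ⟨j, hj, rfl⟩ := hx
        exact Or.inr ⟨j, hj, Submodule.subset_span ⟨j, Set.mem_Iic.2 le_rfl, rfl⟩⟩
      | zero => exact Or.inl rfl
      | add x y _ _ hx hy =>
        rcases hx with rfl | ⟨i, hi, hx⟩
        · simpa using hy
        rcases hy with rfl | ⟨j, hj, hy⟩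
        · right; exact ⟨i, hi, by simpa using hx⟩
        right
        refine ⟨max i j, ?_, add_mem (hmono (le_max_left i j) hx) (hmono (le_max_right i j) hy)⟩
        rcases max_choice i j with h | h <;> rw [h] <;> assumption
      | smul a x _ hx =>
        rcases hx with rfl | ⟨i, hi, hx⟩
        · left; simp
        · right; exact ⟨i, hi, Submodule.smul_mem _ _ hx⟩
    refine step (ι := ι) (fun i => Submodule.span A (b '' Set.Iic i))
      (fun i => Submodule.span A (b '' Set.Iio i)) hmono (fun x => ?_) (fun i x => ⟨hunion _ x, ?_⟩)
      (fun i => gen _ (hIic i)) (fun i => gen _ (hIio i))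
    · have := hunion Set.univ x (by rw [Set.image_univ, hb, hS]; trivial)
      simpa using this
    · rintro (rfl | ⟨j, hj, hx⟩)
      · exact zero_mem _
      · exact Submodule.span_mono (Set.image_mono (Set.Iic_subset_Iio.2 hj)) hx

/-- Let `A` be a finite dimensional algebra over a field `k` and `M` an
`A`-module whose underlying `k`-vector space has dimension at most `ℵ_t` for a finite
ordinal `t`.  Then `M` has pure projective dimension at most `t + 1`; in particular a
countably generated module (`t = 0`) has pure projective dimension at most `1`. -/
theorem stmt12 (k : Type u) [Field k] (A : Type u) [Ring A] [Algebra k A]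
    [FiniteDimensional k A]
    (M : Type u) [AddCommGroup M] [Module A M] [Module k M] [IsScalarTower k A M]
    (t : ℕ) (hdim : Module.rank k M ≤ Cardinal.aleph t) :
    PureProjDimLE A (t + 1) M := by
  haveI : IsNoetherianRing A := isNoetherian_of_tower k inferInstance
  let b := Module.Basis.ofVectorSpace k M
  refine main_card (t + 1) (Set.range b) ?_ ?_
  · rw [eq_top_iff]
    intro x _
    have hx : x ∈ Submodule.span k (Set.range b) := by rw [b.span_eq]; trivial
    exact Submodule.span_le_restrictScalars k A _ hx
  · rw [b.mk_range_eq_rank]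
    refine hdim.trans_lt (Cardinal.aleph_lt_aleph.2 ?_)
    exact_mod_cast Nat.lt_succ_self t
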